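/- Let G be a graph on n vertices with a partition of its vertex set into five parts X1,...,X5, and suppose E_f ≠ ∅. Then the number of induced copies of C5 in G whose vertex set contains at least one funky pair but does not contain two vertex-disjoint funky pairs is at most (9/32)·(dn + 2)·|E_f|·y1²·n². -/

import Mathlib

open scoped Classical

/-- The 5-cycle on `Fin 5`. -/
def C5 : SimpleGraph (Fin 5) := SimpleGraph.fromRel (fun i j => j = i + 1)

/-- Given a partition of the vertices of `G` into five parts (a map `P` to `Fin 5`),
a pair `{u,v}` with `u ∈ X_i`, `v ∈ X_j`, `i ≠ j` is funky if either `uv` is an edge and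
`|i−j| ∈ {2,3}`, or `uv` is a non-edge and `|i−j| ∈ {1,4}`. -/
def Funky {n : ℕ} (G : SimpleGraph (Fin n)) (P : Fin n → Fin 5) (u v : Fin n) : Prop :=
  (G.Adj u v ∧ (((P u : ℕ) : ℤ) - ((P v : ℕ) : ℤ)).natAbs ∈ ({2, 3} : Set ℕ)) ∨
  (¬ G.Adj u v ∧ (((P u : ℕ) : ℤ) - ((P v : ℕ) : ℤ)).natAbs ∈ ({1, 4} : Set ℕ))

/-- The set `E_f` of funky pairs, encoded as ordered pairs `(u,v)` with `u < v`. -/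
noncomputable def funkyPairs {n : ℕ} (G : SimpleGraph (Fin n)) (P : Fin n → Fin 5) :
    Finset (Fin n × Fin n) :=
  Finset.univ.filter fun p => p.1 < p.2 ∧ Funky G P p.1 p.2

/-- `d_f(v)`, the number of funky pairs containing the vertex `v`. -/
noncomputable def fdeg {n : ℕ} (G : SimpleGraph (Fin n)) (P : Fin n → Fin 5)
    (v : Fin n) : ℕ :=
  (Finset.univ.filter fun w => Funky G P v w).card

/-- `d`, the average number of funky pairs incident to a funky pair, divided by `n`:
`d = (Σ_{{u,v} ∈ E_f} (d_f(u) + d_f(v) − 2)) / (|E_f| · n)`. -/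
noncomputable def dAvg {n : ℕ} (G : SimpleGraph (Fin n)) (P : Fin n → Fin 5) : ℝ :=
  (∑ p ∈ funkyPairs G P, ((fdeg G P p.1 : ℝ) + (fdeg G P p.2 : ℝ) - 2)) /
    (((funkyPairs G P).card : ℝ) * (n : ℝ))

/-- `x_i = |X_i| / n`, the normalized size of the `i`-th part. -/
noncomputable def partFrac {n : ℕ} (P : Fin n → Fin 5) (i : Fin 5) : ℝ :=
  (Nat.card {v : Fin n // P v = i} : ℝ) / (n : ℝ)

/-- The number of induced copies of `C5` in `G` whose vertex set contains at least one
funky pair but no two vertex-disjoint funky pairs. -/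
noncomputable def c5FunkyNoTwoDisjoint {n : ℕ} (G : SimpleGraph (Fin n))
    (P : Fin n → Fin 5) : ℕ :=
  Nat.card {s : Finset (Fin n) // s.card = 5 ∧
    Nonempty (G.induce (s : Set (Fin n)) ≃g C5) ∧
    (∃ a b : Fin n, a ∈ s ∧ b ∈ s ∧ Funky G P a b) ∧
    ¬ ∃ a b c d : Fin n, a ∈ s ∧ b ∈ s ∧ c ∈ s ∧ d ∈ s ∧
      a ≠ c ∧ a ≠ d ∧ b ≠ c ∧ b ≠ d ∧ Funky G P a b ∧ Funky G P c d}


def adjB (i j : Fin 5) : Bool := decide (j = i + 1) || decide (i = j + 1)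

def fkB (A B : Fin 5) (e : Bool) : Bool :=
  match e with
  | true => decide (A - B = 2) || decide (A - B = 3)
  | false => decide (A - B = 1) || decide (A - B = 4)

/-- Funkiness of a pair of vertices of the 5-cycle, for a colouring `c`. -/
def fk5 (c : Fin 5 → Fin 5) (i j : Fin 5) : Bool := fkB (c i) (c j) (adjB i j)

def step1 (A B : Fin 5) : Bool := decide (B - A = 1) || decide (B - A = 4)
def step2 (A B : Fin 5) : Bool := decide (B - A = 2) || decide (B - A = 3)

def lastPart (V B D : Fin 5) (f : Bool) : Fin 5 :=
  V + (bif f then 4 else 3) * ((B - V) + (D - V))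

def disj5 (c : Fin 5 → Fin 5) : Prop :=
  ∃ a b, fk5 c a b = true ∧ ∃ u, (a ≠ u ∧ b ≠ u) ∧ ∃ v, (a ≠ v ∧ b ≠ v) ∧ fk5 c u v = true

def full (v b d x y : Fin 5) : Prop := ∀ i : Fin 5, i = v ∨ i = b ∨ i = d ∨ i = x ∨ i = y

def typeA (c : Fin 5 → Fin 5) : Prop :=
  ∃ v b, (fk5 c v b = true ∧ step1 (c v) (c b) = true) ∧
    ∃ d, (fk5 c v d = true ∧ step2 (c v) (c d) = true) ∧
      ∃ x, c x = c v ∧ ∃ y, c y = lastPart (c v) (c b) (c d) (fk5 c b d) ∧ full v b d x y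

def typeB (c : Fin 5 → Fin 5) : Prop :=
  ∃ v p, fk5 c v p = true ∧ ∃ q, (fk5 c v q = true ∧ c q = c p) ∧
    ∃ r, (c r = c p ∧ adjB r p = true ∧ adjB r q = false) ∧
      ∃ t, (c t = c p ∧ adjB t q = true ∧ adjB t p = false) ∧ full v p q r t

instance (v b d x y : Fin 5) : Decidable (full v b d x y) := by unfold full; infer_instance
instance (c : Fin 5 → Fin 5) : Decidable (typeA c) := by unfold typeA; infer_instance
instance (c : Fin 5 → Fin 5) : Decidable (typeB c) := by unfold typeB; infer_instance

/-- The fifteen pairs of disjoint pairs in `Fin 5`. -/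
def pairPairs : List ((Fin 5 × Fin 5) × (Fin 5 × Fin 5)) :=
  [((0, 1), (2, 3)), ((0, 1), (2, 4)), ((0, 1), (3, 4)), ((0, 2), (1, 3)), ((0, 2), (1, 4)),
   ((0, 2), (3, 4)), ((0, 3), (1, 2)), ((0, 3), (1, 4)), ((0, 3), (2, 4)), ((0, 4), (1, 2)),
   ((0, 4), (1, 3)), ((0, 4), (2, 3)), ((1, 2), (3, 4)), ((1, 3), (2, 4)), ((1, 4), (2, 3))]

def disjB (c : Fin 5 → Fin 5) : Bool :=
  pairPairs.any fun t => fk5 c t.1.1 t.1.2 && fk5 c t.2.1 t.2.2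

theorem disj5_of_disjB {c : Fin 5 → Fin 5} (h : disjB c = true) : disj5 c := by
  have hL : ∀ t ∈ pairPairs, (t.1.1 ≠ t.2.1 ∧ t.1.2 ≠ t.2.1) ∧ (t.1.1 ≠ t.2.2 ∧ t.1.2 ≠ t.2.2) := by
    decide +kernel
  rw [disjB, List.any_eq_true] at h
  obtain ⟨t, ht, h⟩ := h
  rw [Bool.and_eq_true] at h
  exact ⟨_, _, h.1, _, (hL t ht).1, _, (hL t ht).2, h.2⟩

set_option maxRecDepth 100000 in
theorem key5 : ∀ c1 c2 c3 c4 : Fin 5,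
    disjB ![0, c1, c2, c3, c4] = true ∨ (∀ i j, fk5 ![0, c1, c2, c3, c4] i j = false) ∨
      typeB ![0, c1, c2, c3, c4] ∨ typeA ![0, c1, c2, c3, c4] := by
  decide +kernel

theorem fk5_shift (c : Fin 5 → Fin 5) (k : Fin 5) : fk5 (fun i => c i - k) = fk5 c := by
  funext i j
  simp only [fk5, fkB, sub_sub_sub_cancel_right]

theorem typeA_shift {c : Fin 5 → Fin 5} {k : Fin 5} (h : typeA fun i => c i - k) : typeA c := by
  simp only [typeA, fk5_shift, step1, step2, lastPart, sub_sub_sub_cancel_right, sub_left_inj] at h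
  obtain ⟨v, b, h1, d, h2, x, hx, y, hy, hF⟩ := h
  refine ⟨v, b, h1, d, h2, x, hx, y, ?_, hF⟩
  rw [sub_add_eq_add_sub, sub_left_inj] at hy
  exact hy

theorem typeB_shift {c : Fin 5 → Fin 5} {k : Fin 5} (h : typeB fun i => c i - k) : typeB c := by
  simpa only [typeB, fk5_shift, sub_left_inj] using h

theorem key5' (c : Fin 5 → Fin 5) (h1 : ¬ disj5 c) (h2 : ∃ i j, fk5 c i j = true) :
    typeA c ∨ typeB c := by
  have h := key5 (c 1 - c 0) (c 2 - c 0) (c 3 - c 0) (c 4 - c 0)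
  have hc : ![0, c 1 - c 0, c 2 - c 0, c 3 - c 0, c 4 - c 0] = fun i => c i - c 0 := by
    funext i
    fin_cases i
    · exact (sub_self _).symm
    all_goals rfl
  rw [hc] at h
  obtain ⟨i, j, hij⟩ := h2
  rcases h with h | h | h | h
  · rw [disjB, fk5_shift] at h
    exact absurd (disj5_of_disjB h) h1
  · rw [fk5_shift] at h
    rw [h i j] at hij; cases hij
  · exact Or.inr (typeB_shift h)
  · exact Or.inl (typeA_shift h)

theorem natAbs_one : ∀ A B : Fin 5, ((((A : ℕ) : ℤ) - ((B : ℕ) : ℤ)).natAbs = 1 ∨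
    (((A : ℕ) : ℤ) - ((B : ℕ) : ℤ)).natAbs = 4) ↔ (A - B = 1 ∨ A - B = 4) := by decide

theorem natAbs_two : ∀ A B : Fin 5, ((((A : ℕ) : ℤ) - ((B : ℕ) : ℤ)).natAbs = 2 ∨
    (((A : ℕ) : ℤ) - ((B : ℕ) : ℤ)).natAbs = 3) ↔ (A - B = 2 ∨ A - B = 3) := by decide

theorem funky_iff {n : ℕ} (G : SimpleGraph (Fin n)) (P : Fin n → Fin 5) (u v : Fin n) :
    Funky G P u v ↔ fkB (P u) (P v) (decide (G.Adj u v)) = true := by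
  unfold Funky
  simp only [Set.mem_insert_iff, Set.mem_singleton_iff, natAbs_one, natAbs_two]
  by_cases h : G.Adj u v <;> simp [h, fkB]

theorem funky_symm {n : ℕ} {G : SimpleGraph (Fin n)} {P : Fin n → Fin 5} {u v : Fin n}
    (h : Funky G P u v) : Funky G P v u := by
  have : ∀ A B : Fin 5, ∀ e, fkB A B e = true → fkB B A e = true := by decide
  rw [funky_iff] at h ⊢
  rw [G.adj_comm v u]
  exact this _ _ _ h

theorem funky_ne {n : ℕ} {G : SimpleGraph (Fin n)} {P : Fin n → Fin 5} {u v : Fin n}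
    (h : Funky G P u v) : P v ≠ P u := by
  have : ∀ A B : Fin 5, ∀ e, fkB A B e = true → B ≠ A := by decide
  rw [funky_iff] at h
  exact this _ _ _ h

theorem C5_adj (i j : Fin 5) : C5.Adj i j ↔ adjB i j = true := by
  have h : ∀ i j : Fin 5, (i ≠ j ∧ (j = i + 1 ∨ i = j + 1)) ↔ adjB i j = true := by decide
  rw [← h]
  simp [C5, SimpleGraph.fromRel_adj]

/-- Funky neighbours of `v` in part `k`. -/
noncomputable def fset {n : ℕ} (G : SimpleGraph (Fin n)) (P : Fin n → Fin 5)
    (v : Fin n) (k : Fin 5) : Finset (Fin n) :=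
  Finset.univ.filter fun w => Funky G P v w ∧ P w = k

noncomputable def fset1 {n : ℕ} (G : SimpleGraph (Fin n)) (P : Fin n → Fin 5)
    (v : Fin n) : Finset (Fin n) :=
  Finset.univ.filter fun w => Funky G P v w ∧ step1 (P v) (P w) = true

noncomputable def fset2 {n : ℕ} (G : SimpleGraph (Fin n)) (P : Fin n → Fin 5)
    (v : Fin n) : Finset (Fin n) :=
  Finset.univ.filter fun w => Funky G P v w ∧ step2 (P v) (P w) = true

noncomputable def part {n : ℕ} (P : Fin n → Fin 5) (k : Fin 5) : Finset (Fin n) :=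
  Finset.univ.filter fun w => P w = k

noncomputable def dset {n : ℕ} (G : SimpleGraph (Fin n)) (X : Finset (Fin n))
    (p q : Fin n) : Finset (Fin n) :=
  X.filter fun r => G.Adj r p ∧ ¬ G.Adj r q

noncomputable def TA {n : ℕ} (G : SimpleGraph (Fin n)) (P : Fin n → Fin 5) :
    Finset (Σ _ : Fin n, Σ _ : Fin n, Σ _ : Fin n, Fin n × Fin n) :=
  Finset.univ.sigma fun v => (fset1 G P v).sigma fun b => (fset2 G P v).sigma fun d =>
    (part P (P v)) ×ˢ (part P (lastPart (P v) (P b) (P d) (decide (Funky G P b d))))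

noncomputable def TB {n : ℕ} (G : SimpleGraph (Fin n)) (P : Fin n → Fin 5) :
    Finset (Σ _ : Fin n, Σ _ : Fin 5, Σ _ : Fin n, Σ _ : Fin n, Fin n × Fin n) :=
  Finset.univ.sigma fun v => Finset.univ.sigma fun k =>
    (fset G P v k).sigma fun p => (fset G P v k).sigma fun q =>
    (dset G (part P k) p q) ×ˢ (dset G (part P k) q p)

noncomputable def mkA {n : ℕ} (t : Σ _ : Fin n, Σ _ : Fin n, Σ _ : Fin n, Fin n × Fin n) :
    Finset (Fin n) := {t.1, t.2.1, t.2.2.1, t.2.2.2.1, t.2.2.2.2}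

noncomputable def mkB {n : ℕ}
    (t : Σ _ : Fin n, Σ _ : Fin 5, Σ _ : Fin n, Σ _ : Fin n, Fin n × Fin n) :
    Finset (Fin n) := {t.1, t.2.2.1, t.2.2.2.1, t.2.2.2.2.1, t.2.2.2.2.2}

theorem two_mul_image {n : ℕ} (G : SimpleGraph (Fin n)) (P : Fin n → Fin 5) :
    2 * ((TB G P).image mkB).card ≤ (TB G P).card := by
  refine Finset.mul_card_image_le_card _ 2 ?_
  intro s hs
  rw [Finset.mem_image] at hs
  obtain ⟨⟨v, k, p, q, r, t⟩, hT, rfl⟩ := hs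
  refine Finset.one_lt_card.2 ⟨⟨v, k, p, q, r, t⟩, by simp [hT], ⟨v, k, q, p, t, r⟩, ?_, ?_⟩
  · rw [Finset.mem_filter]
    constructor
    · simp only [TB, Finset.mem_sigma, Finset.mem_product] at hT ⊢
      tauto
    · ext a
      simp only [mkB, Finset.mem_insert, Finset.mem_singleton]
      tauto
  · simp only [TB, Finset.mem_sigma, Finset.mem_product, dset, Finset.mem_filter] at hT
    intro h
    have hpq : p = q := by
      injection h with _ h
      injection h with _ h
      injection h with h _
    subst hpq
    tauto

theorem cover {n : ℕ} (G : SimpleGraph (Fin n)) (P : Fin n → Fin 5) (s : Finset (Fin n))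
    (h5 : Nonempty (G.induce (s : Set (Fin n)) ≃g C5))
    (hf : ∃ a b : Fin n, a ∈ s ∧ b ∈ s ∧ Funky G P a b)
    (hd : ¬ ∃ a b c d : Fin n, a ∈ s ∧ b ∈ s ∧ c ∈ s ∧ d ∈ s ∧
      a ≠ c ∧ a ≠ d ∧ b ≠ c ∧ b ≠ d ∧ Funky G P a b ∧ Funky G P c d) :
    s ∈ (TA G P).image mkA ∪ (TB G P).image mkB := by
  obtain ⟨φ⟩ := h5
  set e : Fin 5 → Fin n := fun i => (φ.symm i : Fin n) with he
  have hmem : ∀ i, e i ∈ s := fun i => (φ.symm i).2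
  have hinj : Function.Injective e := fun i j h => φ.symm.injective (Subtype.ext h)
  have hsurj : ∀ a ∈ s, ∃ i, e i = a := fun a ha => ⟨φ ⟨a, ha⟩, by simp [he]⟩
  have hadj : ∀ i j, G.Adj (e i) (e j) ↔ adjB i j = true := by
    intro i j
    rw [← C5_adj, ← φ.symm.map_adj_iff]
    simp [he]
  have hfk : ∀ i j, Funky G P (e i) (e j) ↔ fk5 (P ∘ e) i j = true := by
    intro i j
    rw [funky_iff]
    have : decide (G.Adj (e i) (e j)) = adjB i j := by
      rw [Bool.eq_iff_iff, decide_eq_true_iff, hadj]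
    rw [this]; rfl
  have hfull : ∀ v b d x y, full v b d x y → ({e v, e b, e d, e x, e y} : Finset (Fin n)) = s := by
    intro v b d x y h
    ext a
    simp only [Finset.mem_insert, Finset.mem_singleton]
    constructor
    · rintro (h | h | h | h | h) <;> rw [h] <;> exact hmem _
    · intro ha
      obtain ⟨i, rfl⟩ := hsurj a ha
      rcases h i with h | h | h | h | h <;> simp [h]
  have h1 : ¬ disj5 (P ∘ e) := by
    rintro ⟨a, b, hab, u, ⟨h1, h2⟩, v, ⟨h3, h4⟩, huv⟩
    exact hd ⟨e a, e b, e u, e v, hmem _, hmem _, hmem _, hmem _, hinj.ne h1, hinj.ne h3,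
      hinj.ne h2, hinj.ne h4, (hfk _ _).2 hab, (hfk _ _).2 huv⟩
  have h2 : ∃ i j, fk5 (P ∘ e) i j = true := by
    obtain ⟨a, b, ha, hb, hab⟩ := hf
    obtain ⟨i, rfl⟩ := hsurj a ha
    obtain ⟨j, rfl⟩ := hsurj b hb
    exact ⟨i, j, (hfk _ _).1 hab⟩
  rw [Finset.mem_union, Finset.mem_image, Finset.mem_image]
  rcases key5' _ h1 h2 with h | h
  · left
    obtain ⟨v, b, ⟨hb, hb'⟩, d, ⟨hd, hd'⟩, x, hx, y, hy, hF⟩ := h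
    refine ⟨⟨e v, e b, e d, e x, e y⟩, ?_, hfull _ _ _ _ _ hF⟩
    simp only [TA, Finset.mem_sigma, Finset.mem_product, fset1, fset2, part, Finset.mem_filter,
      Finset.mem_univ, true_and, hfk]
    exact ⟨⟨hb, hb'⟩, ⟨hd, hd'⟩, hx, by
      rw [Bool.decide_eq_true]; exact hy⟩
  · right
    obtain ⟨v, p, hp, q, ⟨hq, hqp⟩, r, ⟨hr, hr1, hr2⟩, t, ⟨ht, ht1, ht2⟩, hF⟩ := h
    refine ⟨⟨e v, P (e p), e p, e q, e r, e t⟩, ?_, hfull _ _ _ _ _ hF⟩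
    simp only [TB, Finset.mem_sigma, Finset.mem_product, fset, dset, part, Finset.mem_filter,
      Finset.mem_univ, true_and, hfk, hadj]
    exact ⟨⟨hp, trivial⟩, ⟨hq, hqp⟩, ⟨hr, hr1, by simp [hr2]⟩, ht, ht1, by simp [ht2]⟩

/-- Counting induced matchings between `F` and `X`. -/
theorem matching_bound {n : ℕ} (G : SimpleGraph (Fin n)) (X F : Finset (Fin n)) :
    (∑ p ∈ F, ∑ q ∈ F, ((dset G X p q).card : ℝ) * ((dset G X q p).card : ℝ)) ≤
      (X.card : ℝ) ^ 2 * (F.card : ℝ) ^ 2 / 8 := by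
  have h1 : ∀ p q, ((dset G X p q).card : ℝ) * ((dset G X q p).card : ℝ) ≤
      (X.card : ℝ) / 4 * (((dset G X p q).card : ℝ) + ((dset G X q p).card : ℝ)) := by
    intro p q
    have hd : Disjoint (dset G X p q) (dset G X q p) := by
      rw [Finset.disjoint_left]
      intro a ha hb
      simp only [dset, Finset.mem_filter] at ha hb
      tauto
    have hle : (dset G X p q).card + (dset G X q p).card ≤ X.card := by
      rw [← Finset.card_union_of_disjoint hd]
      apply Finset.card_le_card
      exact Finset.union_subset (Finset.filter_subset _ _) (Finset.filter_subset _ _)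
    have hle' : ((dset G X p q).card : ℝ) + ((dset G X q p).card : ℝ) ≤ X.card := by
      exact_mod_cast hle
    have ha : (0 : ℝ) ≤ (dset G X p q).card := by positivity
    have hb : (0 : ℝ) ≤ (dset G X q p).card := by positivity
    nlinarith [sq_nonneg (((dset G X p q).card : ℝ) - ((dset G X q p).card : ℝ)),
      mul_nonneg (sub_nonneg.2 hle') (add_nonneg ha hb)]
  have h2 : (∑ p ∈ F, ∑ q ∈ F, ((dset G X p q).card : ℝ)) ≤
      (X.card : ℝ) * (F.card : ℝ) ^ 2 / 4 := by
    have h3 : (∑ p ∈ F, ∑ q ∈ F, ((dset G X p q).card : ℝ)) =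
        ∑ r ∈ X, ((F.filter fun p => G.Adj r p).card : ℝ) *
          ((F.filter fun q => ¬ G.Adj r q).card : ℝ) := by
      have h4 : ∀ p q, ((dset G X p q).card : ℝ) =
          ∑ r ∈ X, (if G.Adj r p then (1 : ℝ) else 0) * (if ¬ G.Adj r q then (1 : ℝ) else 0) := by
        intro p q
        rw [dset, Finset.card_filter]
        push_cast
        refine Finset.sum_congr rfl fun r _ => ?_
        by_cases h : G.Adj r p <;> by_cases h' : G.Adj r q <;> simp [h, h']
      simp only [h4]
      rw [Finset.sum_congr rfl fun p _ => Finset.sum_comm, Finset.sum_comm]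
      refine Finset.sum_congr rfl fun r _ => ?_
      rw [← Finset.sum_mul_sum, Finset.card_filter, Finset.card_filter]
      push_cast
      rfl
    rw [h3]
    calc _ ≤ ∑ r ∈ X, (F.card : ℝ) ^ 2 / 4 := by
          refine Finset.sum_le_sum fun r _ => ?_
          have h5 := Finset.card_filter_add_card_filter_not (s := F) (fun p => G.Adj r p)
          have h6 : ((F.filter fun p => G.Adj r p).card : ℝ) +
              ((F.filter fun q => ¬ G.Adj r q).card : ℝ) = F.card := by exact_mod_cast h5
          rw [← h6]
          nlinarith [sq_nonneg (((F.filter fun p => G.Adj r p).card : ℝ) -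
            ((F.filter fun q => ¬ G.Adj r q).card : ℝ))]
      _ = _ := by rw [Finset.sum_const, nsmul_eq_mul]; ring
  calc _ ≤ ∑ p ∈ F, ∑ q ∈ F, (X.card : ℝ) / 4 *
        (((dset G X p q).card : ℝ) + ((dset G X q p).card : ℝ)) :=
        Finset.sum_le_sum fun p _ => Finset.sum_le_sum fun q _ => h1 p q
    _ = (X.card : ℝ) / 4 * (2 * ∑ p ∈ F, ∑ q ∈ F, ((dset G X p q).card : ℝ)) := by
        simp only [← Finset.mul_sum, Finset.sum_add_distrib]
        rw [Finset.sum_comm (f := fun p q => ((dset G X q p).card : ℝ))]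
        ring
    _ ≤ (X.card : ℝ) / 4 * (2 * ((X.card : ℝ) * (F.card : ℝ) ^ 2 / 4)) := by gcongr
    _ = _ := by ring

theorem sum_sq {n : ℕ} (G : SimpleGraph (Fin n)) (P : Fin n → Fin 5) (v : Fin n) :
    (∑ k, ((fset G P v k).card : ℝ) ^ 2) ≤
      ((fset1 G P v).card : ℝ) ^ 2 + ((fset2 G P v).card : ℝ) ^ 2 := by
  have h0 : (fset G P v (P v + 0)).card = 0 := by
    rw [Finset.card_eq_zero, fset, Finset.filter_eq_empty_iff]
    rintro w - ⟨h, h'⟩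
    exact funky_ne h (by simpa using h')
  have aux : ∀ a b : Fin 5, a ≠ b → Disjoint (fset G P v (P v + a)) (fset G P v (P v + b)) := by
    intro a b hab
    rw [Finset.disjoint_left]
    intro w h h'
    simp only [fset, Finset.mem_filter] at h h'
    exact hab (add_left_cancel (h.2.2.symm.trans h'.2.2))
  have e1 : ∀ A B : Fin 5, step1 A B = true ↔ (B = A + 1 ∨ B = A + 4) := by decide
  have e2 : ∀ A B : Fin 5, step2 A B = true ↔ (B = A + 2 ∨ B = A + 3) := by decide
  have h1 : (fset1 G P v).card = (fset G P v (P v + 1)).card + (fset G P v (P v + 4)).card := by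
    rw [← Finset.card_union_of_disjoint (aux 1 4 (by decide))]
    congr 1
    ext w
    simp only [fset, fset1, Finset.mem_union, Finset.mem_filter, e1]
    tauto
  have h2 : (fset2 G P v).card = (fset G P v (P v + 2)).card + (fset G P v (P v + 3)).card := by
    rw [← Finset.card_union_of_disjoint (aux 2 3 (by decide))]
    congr 1
    ext w
    simp only [fset, fset2, Finset.mem_union, Finset.mem_filter, e2]
    tauto
  rw [← Equiv.sum_comp (Equiv.addLeft (P v)), Fin.sum_univ_five]
  simp only [Equiv.coe_addLeft, h0, h1, h2]
  push_cast
  have : ∀ a b : Fin 5, 0 ≤ ((fset G P v a).card : ℝ) * ((fset G P v b).card : ℝ) := by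
    intros; positivity
  nlinarith [this (P v + 1) (P v + 4), this (P v + 2) (P v + 3)]

theorem fdeg_eq {n : ℕ} (G : SimpleGraph (Fin n)) (P : Fin n → Fin 5) (v : Fin n) :
    fdeg G P v = (fset1 G P v).card + (fset2 G P v).card := by
  have e : ∀ A B : Fin 5, B ≠ A → ((step1 A B = true ∨ step2 A B = true) ∧
      ¬ (step1 A B = true ∧ step2 A B = true)) := by decide
  rw [← Finset.card_union_of_disjoint, fdeg]
  · congr 1
    ext w
    simp only [fset1, fset2, Finset.mem_union, Finset.mem_filter, Finset.mem_univ, true_and]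
    constructor
    · intro h
      have := e _ _ (funky_ne h)
      tauto
    · rintro (h | h) <;> exact h.1
  · rw [Finset.disjoint_left]
    intro w h h'
    simp only [fset1, fset2, Finset.mem_filter, Finset.mem_univ, true_and] at h h'
    have := e _ _ (funky_ne h.1)
    tauto

theorem sum_deg {n : ℕ} (G : SimpleGraph (Fin n)) (P : Fin n → Fin 5) :
    (∑ p ∈ funkyPairs G P, ((fdeg G P p.1 : ℝ) + (fdeg G P p.2 : ℝ))) =
      ∑ v, (fdeg G P v : ℝ) ^ 2 := by
  have h1 : (∑ v, (fdeg G P v : ℝ) ^ 2) =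
      ∑ v, ∑ w, (if Funky G P v w then (fdeg G P v : ℝ) else 0) := by
    refine Finset.sum_congr rfl fun v _ => ?_
    rw [← Finset.sum_filter, Finset.sum_const, nsmul_eq_mul, sq]
    rfl
  have h2 : ∀ v w, (if Funky G P v w then (fdeg G P v : ℝ) else 0) =
      (if v < w ∧ Funky G P v w then (fdeg G P v : ℝ) else 0) +
      (if w < v ∧ Funky G P w v then (fdeg G P v : ℝ) else 0) := by
    intro v w
    by_cases h : Funky G P v w
    · have h' := funky_symm h
      have hne : v ≠ w := fun e => funky_ne h (by rw [e])
      rcases lt_or_gt_of_ne hne with hl | hl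
      · simp [h, hl, hl.not_gt]
      · simp [h, h', hl, hl.not_gt]
    · have h' : ¬ Funky G P w v := fun h' => h (funky_symm h')
      simp [h, h']
  rw [h1, funkyPairs, Finset.sum_filter, Fintype.sum_prod_type]
  simp only [h2, Finset.sum_add_distrib]
  rw [Finset.sum_comm (f := fun v w => if w < v ∧ Funky G P w v then (fdeg G P v : ℝ) else 0)]
  rw [← Finset.sum_add_distrib]
  refine Finset.sum_congr rfl fun v _ => ?_
  rw [← Finset.sum_add_distrib]
  refine Finset.sum_congr rfl fun w _ => ?_
  by_cases h : v < w ∧ Funky G P v w <;> simp [h]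

theorem card_TA {n : ℕ} (G : SimpleGraph (Fin n)) (P : Fin n → Fin 5) (M : ℝ)
    (hM : ∀ k, ((part P k).card : ℝ) ≤ M) :
    ((TA G P).card : ℝ) ≤ ∑ v, ((fset1 G P v).card : ℝ) * ((fset2 G P v).card : ℝ) * M ^ 2 := by
  have hM0 : 0 ≤ M := le_trans (by positivity) (hM 0)
  simp only [TA, Finset.card_sigma, Finset.card_product]
  push_cast
  refine Finset.sum_le_sum fun v _ => ?_
  calc _ ≤ ∑ b ∈ fset1 G P v, ∑ d ∈ fset2 G P v, M * M := by
        refine Finset.sum_le_sum fun b _ => Finset.sum_le_sum fun d _ => ?_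
        exact mul_le_mul (hM _) (hM _) (by positivity) hM0
    _ = _ := by
        simp only [Finset.sum_const, nsmul_eq_mul]
        ring

theorem card_TB {n : ℕ} (G : SimpleGraph (Fin n)) (P : Fin n → Fin 5) (M : ℝ)
    (hM : ∀ k, ((part P k).card : ℝ) ≤ M) :
    ((TB G P).card : ℝ) ≤
      ∑ v, M ^ 2 / 8 * (((fset1 G P v).card : ℝ) ^ 2 + ((fset2 G P v).card : ℝ) ^ 2) := by
  have hM0 : 0 ≤ M := le_trans (by positivity) (hM 0)
  simp only [TB, Finset.card_sigma, Finset.card_product]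
  push_cast
  refine Finset.sum_le_sum fun v _ => ?_
  calc _ ≤ ∑ k, M ^ 2 / 8 * ((fset G P v k).card : ℝ) ^ 2 := by
        refine Finset.sum_le_sum fun k _ => ?_
        refine (matching_bound G (part P k) (fset G P v k)).trans ?_
        have : ((part P k).card : ℝ) ^ 2 ≤ M ^ 2 := pow_le_pow_left₀ (by positivity) (hM k) 2
        nlinarith [mul_le_mul_of_nonneg_right this (sq_nonneg ((fset G P v k).card : ℝ))]
    _ ≤ _ := by
        rw [← Finset.mul_sum]
        exact mul_le_mul_of_nonneg_left (sum_sq G P v) (by positivity)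

/-- Claim 8 (Claim `count2`): the number of induced 5-cycles containing at least one
funky pair but no two vertex-disjoint funky pairs is at most
`(9/32)·(dn + 2)·|E_f|·y₁²·n²`. -/
theorem count_funky_no_two_disjoint (n : ℕ) (G : SimpleGraph (Fin n))
    (P : Fin n → Fin 5) (hEf : (funkyPairs G P).Nonempty)
    (y : Fin 5 → ℝ) (σ : Equiv.Perm (Fin 5))
    (hy : ∀ i, y i = partFrac P (σ i))
    (hmono : ∀ i j : Fin 5, i ≤ j → y j ≤ y i) :
    (c5FunkyNoTwoDisjoint G P : ℝ) ≤
      (9 / 32) * (dAvg G P * (n : ℝ) + 2) * ((funkyPairs G P).card : ℝ) *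
        (y 0) ^ 2 * (n : ℝ) ^ 2 := by
  have hn : (n : ℝ) ≠ 0 := by
    obtain ⟨p, -⟩ := hEf
    have := p.1.pos
    positivity
  have hE : ((funkyPairs G P).card : ℝ) ≠ 0 := by
    have := hEf.card_pos
    positivity
  have hpart : ∀ k, ((part P k).card : ℝ) = partFrac P k * n := by
    intro k
    rw [partFrac, div_mul_cancel₀ _ hn, Nat.card_eq_fintype_card, Fintype.card_subtype]
    rfl
  have hM : ∀ k, ((part P k).card : ℝ) ≤ y 0 * n := by
    intro k
    rw [hpart]
    have h1 := hmono 0 (σ.symm k) (Fin.zero_le _)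
    rw [hy (σ.symm k), Equiv.apply_symm_apply] at h1
    exact mul_le_mul_of_nonneg_right h1 (by positivity)
  have hd : (dAvg G P * (n : ℝ) + 2) * ((funkyPairs G P).card : ℝ) =
      ∑ v, (fdeg G P v : ℝ) ^ 2 := by
    rw [← sum_deg, dAvg, Finset.sum_sub_distrib, Finset.sum_const, nsmul_eq_mul]
    field_simp
    ring
  have hcard : c5FunkyNoTwoDisjoint G P ≤
      ((TA G P).image mkA ∪ (TB G P).image mkB).card := by
    rw [c5FunkyNoTwoDisjoint, Nat.card_eq_fintype_card, Fintype.card_subtype]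
    refine Finset.card_le_card fun s hs => ?_
    rw [Finset.mem_filter] at hs
    exact cover G P s hs.2.2.1 hs.2.2.2.1 hs.2.2.2.2
  have h1 : c5FunkyNoTwoDisjoint G P ≤ (TA G P).card + ((TB G P).image mkB).card :=
    hcard.trans ((Finset.card_union_le _ _).trans (Nat.add_le_add_right Finset.card_image_le _))
  have h1' : (c5FunkyNoTwoDisjoint G P : ℝ) ≤
      (TA G P).card + (((TB G P).image mkB).card : ℝ) := by exact_mod_cast h1
  have h2 : 2 * (((TB G P).image mkB).card : ℝ) ≤ (TB G P).card := by
    exact_mod_cast two_mul_image G P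
  have hA := card_TA G P _ hM
  have hB := card_TB G P _ hM
  have hfin : (∑ v, ((fset1 G P v).card : ℝ) * ((fset2 G P v).card : ℝ) * (y 0 * n) ^ 2) +
      (∑ v, (y 0 * n) ^ 2 / 8 *
        (((fset1 G P v).card : ℝ) ^ 2 + ((fset2 G P v).card : ℝ) ^ 2)) / 2 ≤
      9 / 32 * (∑ v, (fdeg G P v : ℝ) ^ 2) * (y 0 * n) ^ 2 := by
    rw [Finset.sum_div, ← Finset.sum_add_distrib, Finset.mul_sum, Finset.sum_mul]
    refine Finset.sum_le_sum fun v _ => ?_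
    rw [fdeg_eq]
    push_cast
    nlinarith [mul_nonneg (sq_nonneg (y 0 * (n : ℝ)))
      (sq_nonneg (((fset1 G P v).card : ℝ) - ((fset2 G P v).card : ℝ)))]
  calc (c5FunkyNoTwoDisjoint G P : ℝ) ≤ 9 / 32 * (∑ v, (fdeg G P v : ℝ) ^ 2) * (y 0 * n) ^ 2 := by
        linarith
    _ = _ := by rw [← hd]; ring
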